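/- Let γ ∈ [−3, 1]. There exists a constant C > 0, depending only on γ, such that for all measurable functions f, h : ℝ³ → ℝ and every continuously differentiable function g : ℝ³ → ℝ, ∫_{ℝ³} ∫_{ℝ³} |v − v_*|^{γ+1} |f(v_*)| |g(v)| |h(v)| dv_* dv ≤ C · ‖f‖_{L²_5} · ‖g‖_{H¹_{γ/2+1}} · ‖h‖_{L²_{γ/2}}. -/

import Mathlib

open MeasureTheory ENNReal

noncomputable section

/-- Japanese bracket `⟨v⟩ = (1 + |v|²)^(1/2)`. -/
def jb (v : EuclideanSpace ℝ (Fin 3)) : ℝ := (1 + ‖v‖ ^ 2) ^ ((1 : ℝ) / 2)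

/-- Weighted `L²` norm `‖⟨v⟩^l f‖_{L²(ℝ³)}` (with values in `[0,∞]`). -/
def eL2w (l : ℝ) (f : EuclideanSpace ℝ (Fin 3) → ℝ) : ℝ≥0∞ :=
  (∫⁻ v, (ENNReal.ofReal (jb v ^ l * |f v|)) ^ (2 : ℕ)) ^ ((1 : ℝ) / 2)

/-- Weighted `L²` norm of the gradient, `‖⟨v⟩^l ∇f‖_{L²(ℝ³)}`. -/
def eL2gradw (l : ℝ) (f : EuclideanSpace ℝ (Fin 3) → ℝ) : ℝ≥0∞ :=
  (∫⁻ v, (ENNReal.ofReal (jb v ^ l * ‖gradient f v‖)) ^ (2 : ℕ)) ^ ((1 : ℝ) / 2)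

/-- Weighted first-order Sobolev norm `‖f‖_{H¹_l} = ‖⟨v⟩^l f‖_{L²} + ‖⟨v⟩^l ∇f‖_{L²}`. -/
def eH1w (l : ℝ) (f : EuclideanSpace ℝ (Fin 3) → ℝ) : ℝ≥0∞ :=
  eL2w l f + eL2gradw l f


local notation "E3" => EuclideanSpace ℝ (Fin 3)

theorem lintegral_mul_le_sqrt_mul_sqrt {α : Type*} [MeasurableSpace α] {μ : Measure α}
    {a b : α → ℝ≥0∞} (ha : AEMeasurable a μ) (hb : AEMeasurable b μ) :
    ∫⁻ x, a x * b x ∂μ ≤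
      (∫⁻ x, a x ^ 2 ∂μ) ^ ((1 : ℝ) / 2) * (∫⁻ x, b x ^ 2 ∂μ) ^ ((1 : ℝ) / 2) := by
  have h := ENNReal.lintegral_mul_le_Lp_mul_Lq μ Real.HolderConjugate.two_two ha hb
  simpa only [ENNReal.rpow_two, Pi.mul_apply] using h

theorem sq_rpow_half (x : ℝ≥0∞) : (x ^ 2) ^ ((1 : ℝ) / 2) = x := by
  rw [← ENNReal.rpow_natCast, ← ENNReal.rpow_mul]; norm_num

theorem rpow_half_sq (x : ℝ≥0∞) : (x ^ ((1 : ℝ) / 2)) ^ 2 = x := by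
  rw [← ENNReal.rpow_natCast, ← ENNReal.rpow_mul]; norm_num

theorem lintegral_comp_smul_euclidean {R : ℝ} (hR : 0 < R) (u : E3 → ℝ≥0∞) :
    ∫⁻ x, u (R • x) = ENNReal.ofReal (R ^ 3)⁻¹ * ∫⁻ x, u x := by
  have hm : MeasurableEmbedding (fun x : E3 => R • x) :=
    (Homeomorph.smulOfNeZero R hR.ne').measurableEmbedding
  rw [← hm.lintegral_map, Measure.map_addHaar_smul _ hR.ne', lintegral_smul_measure]
  simp [abs_of_pos hR]

theorem lintegral_inv_norm_sq_ball_lt_top :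
    ∫⁻ x in Metric.ball (0 : E3) 1, ENNReal.ofReal (‖x‖⁻¹ ^ 2) < ∞ := by
  have h : Integrable (fun x : E3 => (Set.Iio (1 : ℝ)).indicator (fun r => r⁻¹ ^ 2) ‖x‖) := by
    rw [integrable_fun_norm_addHaar (volume : Measure E3)
      (f := (Set.Iio (1 : ℝ)).indicator (fun r => r⁻¹ ^ 2))]
    have h1 : IntegrableOn ((Set.Iio (1 : ℝ)).indicator (fun _ => (1 : ℝ))) (Set.Ioi 0) := by
      rw [integrableOn_indicator_iff measurableSet_Iio]
      simp [Set.Iio_inter_Ioi]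
    refine h1.congr_fun ?_ measurableSet_Ioi
    intro y hy
    have : y ≠ 0 := ne_of_gt hy
    by_cases hy1 : y < 1 <;> simp [Set.indicator, hy1, this]
  have h2 := h.lintegral_lt_top
  rw [← lintegral_indicator Metric.isOpen_ball.measurableSet]
  refine lt_of_le_of_lt (lintegral_mono fun x => ?_) h2
  by_cases hx : ‖x‖ < 1 <;> simp [Set.indicator, hx]

theorem enorm_sq_sub_dilation_le {g : E3 → ℝ} (hg : ContDiff ℝ 1 g) (x : E3) :
    ‖g x‖ₑ ^ 2 ≤ 2 * ‖g ((4 : ℝ) • x)‖ₑ ^ 2 +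
      6 * (‖x‖ₑ ^ 2 * ∫⁻ t in Set.Ioc (1 : ℝ) 4, ‖fderiv ℝ g (t • x)‖ₑ ^ 2) := by
  have hcont : Continuous (fderiv ℝ g) := hg.continuous_fderiv (by norm_num)
  have hd : ∀ t : ℝ, HasDerivAt (fun t : ℝ => g (t • x)) (fderiv ℝ g (t • x) x) t := by
    intro t
    have h1 : HasDerivAt (fun t : ℝ => t • x) x t := by
      simpa using (hasDerivAt_id t).smul_const x
    exact ((hg.differentiable (by norm_num)) (t • x)).hasFDerivAt.comp_hasDerivAt t h1
  have hc' : Continuous (fun t : ℝ => fderiv ℝ g (t • x) x) := by fun_prop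
  have hftc : ∫ t in (1 : ℝ)..4, fderiv ℝ g (t • x) x = g ((4 : ℝ) • x) - g x := by
    rw [intervalIntegral.integral_eq_sub_of_hasDerivAt (fun t _ => hd t)
      (hc'.intervalIntegrable _ _)]
    simp
  set I := ∫ t in (1 : ℝ)..4, fderiv ℝ g (t • x) x with hI
  have hIle : ‖I‖ₑ ≤ ‖x‖ₑ * ∫⁻ t in Set.Ioc (1 : ℝ) 4, ‖fderiv ℝ g (t • x)‖ₑ := by
    rw [hI, intervalIntegral.integral_of_le (by norm_num), ← lintegral_const_mul _ (by fun_prop)]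
    refine (enorm_integral_le_lintegral_enorm _).trans (lintegral_mono fun t => ?_)
    rw [mul_comm]
    exact ContinuousLinearMap.le_opENorm _ _
  have hI2 : ‖I‖ₑ ^ 2 ≤
      3 * (‖x‖ₑ ^ 2 * ∫⁻ t in Set.Ioc (1 : ℝ) 4, ‖fderiv ℝ g (t • x)‖ₑ ^ 2) := by
    have hcs := lintegral_mul_le_sqrt_mul_sqrt (μ := volume.restrict (Set.Ioc (1 : ℝ) 4))
      (a := fun t => ‖fderiv ℝ g (t • x)‖ₑ) (b := fun _ => 1) (by fun_prop) (by fun_prop)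
    have hcs2 := pow_le_pow_left₀ zero_le hcs 2
    rw [mul_pow, rpow_half_sq, rpow_half_sq] at hcs2
    have h3 : ENNReal.ofReal (4 - 1) = 3 := by norm_num
    simp only [mul_one, one_pow, lintegral_const, one_mul, Measure.restrict_apply_univ,
      Real.volume_Ioc, h3] at hcs2
    calc ‖I‖ₑ ^ 2 ≤ (‖x‖ₑ * ∫⁻ t in Set.Ioc (1 : ℝ) 4, ‖fderiv ℝ g (t • x)‖ₑ) ^ 2 := by gcongr
      _ ≤ ‖x‖ₑ ^ 2 * ((∫⁻ t in Set.Ioc (1 : ℝ) 4, ‖fderiv ℝ g (t • x)‖ₑ ^ 2) * 3) := by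
        rw [mul_pow]; gcongr
      _ = _ := by ring
  have hreal : g x ^ 2 ≤ 2 * g ((4 : ℝ) • x) ^ 2 + 2 * I ^ 2 := by
    have : g x = g ((4 : ℝ) • x) - I := by rw [hftc]; ring
    rw [this]
    nlinarith [sq_nonneg (g ((4 : ℝ) • x) + I)]
  have henn : ‖g x‖ₑ ^ 2 ≤ 2 * ‖g ((4 : ℝ) • x)‖ₑ ^ 2 + 2 * ‖I‖ₑ ^ 2 := by
    have hsq : ∀ y : ℝ, ‖y‖ₑ ^ 2 = ENNReal.ofReal (y ^ 2) := fun y => by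
      rw [Real.enorm_eq_ofReal_abs, ← ENNReal.ofReal_pow (abs_nonneg _), sq_abs]
    rw [hsq, hsq, hsq]
    refine (ENNReal.ofReal_le_ofReal hreal).trans (le_of_eq ?_)
    rw [ENNReal.ofReal_add (by positivity) (by positivity), ENNReal.ofReal_mul (by norm_num),
      ENNReal.ofReal_mul (by norm_num)]
    simp
  calc _ ≤ _ := henn
    _ ≤ 2 * ‖g ((4 : ℝ) • x)‖ₑ ^ 2 +
      2 * (3 * (‖x‖ₑ ^ 2 * ∫⁻ t in Set.Ioc (1 : ℝ) 4, ‖fderiv ℝ g (t • x)‖ₑ ^ 2)) := by gcongr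
    _ = _ := by ring

theorem lintegral_ball_comp_smul_le {R : ℝ} (hR : 1 ≤ R) {S : ℝ} (hRS : R ≤ S) (u : E3 → ℝ≥0∞) :
    ∫⁻ x in Metric.ball (0 : E3) 1, u (R • x) ≤
      ENNReal.ofReal (R ^ 3)⁻¹ * ∫⁻ x in Metric.ball (0 : E3) S, u x := by
  have hR0 : 0 < R := by linarith
  rw [← lintegral_indicator Metric.isOpen_ball.measurableSet,
    ← lintegral_indicator Metric.isOpen_ball.measurableSet,
    ← lintegral_comp_smul_euclidean hR0]
  refine lintegral_mono fun x => ?_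
  by_cases hx : x ∈ Metric.ball (0 : E3) 1
  · have hx' : R • x ∈ Metric.ball (0 : E3) S := by
      simp only [mem_ball_zero_iff, norm_smul, Real.norm_eq_abs, abs_of_pos hR0] at hx ⊢
      nlinarith [norm_nonneg x]
    rw [Set.indicator_of_mem hx, Set.indicator_of_mem hx']
  · simp [hx]

theorem lintegral_inv_norm_sq_mul_ball_le {g : E3 → ℝ} (hg : ContDiff ℝ 1 g) :
    ∫⁻ x in Metric.ball (0 : E3) 1, ‖‖x‖⁻¹‖ₑ ^ 2 * ‖g x‖ₑ ^ 2 ≤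
      ∫⁻ x in Metric.ball (0 : E3) 4, (‖g x‖ₑ ^ 2 + 12 * 3 * ‖fderiv ℝ g x‖ₑ ^ 2) := by
  have hcont : Continuous (fderiv ℝ g) := hg.continuous_fderiv (by norm_num)
  have hgc : Continuous g := hg.continuous
  set w : E3 → ℝ≥0∞ := fun x => ‖‖x‖⁻¹‖ₑ ^ 2 * ‖g x‖ₑ ^ 2 with hw
  have hwm : Measurable w := by
    have := hgc.measurable
    fun_prop
  set N := ∫⁻ x in Metric.ball (0 : E3) 1, w x with hN
  set A := ∫⁻ x in Metric.ball (0 : E3) 4, ‖g x‖ₑ ^ 2 with hA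
  set D := ∫⁻ x in Metric.ball (0 : E3) 4, ‖fderiv ℝ g x‖ₑ ^ 2 with hD
  have hNfin : N ≠ ∞ := by
    obtain ⟨M, hM⟩ := (isCompact_closedBall (0 : E3) 1).exists_bound_of_continuousOn
      hgc.continuousOn
    refine ne_top_of_le_ne_top (ENNReal.mul_ne_top
      lintegral_inv_norm_sq_ball_lt_top.ne (ENNReal.ofReal_ne_top (r := M ^ 2))) ?_
    rw [← lintegral_mul_const' _ _ ENNReal.ofReal_ne_top]
    refine setLIntegral_mono' Metric.isOpen_ball.measurableSet fun x hx => ?_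
    have hb := hM x (Metric.ball_subset_closedBall hx)
    rw [hw]
    simp only
    rw [Real.enorm_eq_ofReal (by positivity), ← ENNReal.ofReal_pow (by positivity),
      ← ofReal_norm, ← ENNReal.ofReal_pow (by positivity)]
    gcongr
  have hpt : ∀ x, w x ≤ 2 * (16 * w ((4 : ℝ) • x)) +
      6 * ∫⁻ t in Set.Ioc (1 : ℝ) 4, ‖fderiv ℝ g (t • x)‖ₑ ^ 2 := by
    intro x
    by_cases hx : x = 0
    · simp [hw, hx]
    have hxn : ‖x‖ ≠ 0 := norm_ne_zero_iff.mpr hx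
    have h1 : ‖‖x‖⁻¹‖ₑ ^ 2 * ‖x‖ₑ ^ 2 = 1 := by
      rw [← mul_pow, ← enorm_norm x, ← enorm_mul, inv_mul_cancel₀ hxn]; simp
    have h4 : 16 * ‖‖(4 : ℝ) • x‖⁻¹‖ₑ ^ 2 = ‖‖x‖⁻¹‖ₑ ^ 2 := by
      have h16 : (16 : ℝ≥0∞) = ‖(4 : ℝ)‖ₑ ^ 2 := by
        rw [Real.enorm_eq_ofReal (by norm_num)]; norm_num
      rw [h16, ← mul_pow, ← enorm_mul, norm_smul]
      congr 2
      norm_num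
      field_simp
    calc w x ≤ ‖‖x‖⁻¹‖ₑ ^ 2 * (2 * ‖g ((4 : ℝ) • x)‖ₑ ^ 2 +
        6 * (‖x‖ₑ ^ 2 * ∫⁻ t in Set.Ioc (1 : ℝ) 4, ‖fderiv ℝ g (t • x)‖ₑ ^ 2)) := by
          simp only [hw]
          gcongr
          exact enorm_sq_sub_dilation_le hg x
      _ = 2 * (‖‖x‖⁻¹‖ₑ ^ 2 * ‖g ((4 : ℝ) • x)‖ₑ ^ 2) + 6 * ((‖‖x‖⁻¹‖ₑ ^ 2 * ‖x‖ₑ ^ 2) *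
          ∫⁻ t in Set.Ioc (1 : ℝ) 4, ‖fderiv ℝ g (t • x)‖ₑ ^ 2) := by ring
      _ = _ := by rw [h1, one_mul, ← h4]; simp only [hw]; ring
  have hW4 : ∫⁻ x in Metric.ball (0 : E3) 4, w x ≤ N + A := by
    have hsub : Metric.ball (0 : E3) 4 = Metric.ball 0 1 ∪ (Metric.ball 0 4 \ Metric.ball 0 1) :=
      (Set.union_sdiff_cancel (Metric.ball_subset_ball (by norm_num))).symm
    rw [hsub]
    refine (lintegral_union_le _ _ _).trans ?_
    gcongr
    refine (setLIntegral_mono' (g := fun x => ‖g x‖ₑ ^ 2)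
      (Metric.isOpen_ball.measurableSet.diff Metric.isOpen_ball.measurableSet)
      fun x hx => ?_).trans (lintegral_mono_set Set.sdiff_subset)
    have hx1 : 1 ≤ ‖x‖ := by simpa using hx.2
    have : ‖‖x‖⁻¹‖ₑ ≤ 1 := by
      rw [Real.enorm_eq_ofReal (by positivity)]
      exact ENNReal.ofReal_le_one.2 (inv_le_one_of_one_le₀ hx1)
    calc w x ≤ 1 ^ 2 * ‖g x‖ₑ ^ 2 := by simp only [hw]; gcongr
      _ = _ := by simp
  have hS : ∫⁻ x in Metric.ball (0 : E3) 1, w ((4 : ℝ) • x) ≤ ENNReal.ofReal (1 / 64) * (N + A) := by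
    refine (lintegral_ball_comp_smul_le (by norm_num) le_rfl w).trans ?_
    norm_num
    gcongr
  have hDD : ∫⁻ x in Metric.ball (0 : E3) 1, ∫⁻ t in Set.Ioc (1 : ℝ) 4,
      ‖fderiv ℝ g (t • x)‖ₑ ^ 2 ≤ 3 * D := by
    rw [lintegral_lintegral_swap (by fun_prop)]
    calc _ ≤ ∫⁻ t in Set.Ioc (1 : ℝ) 4, D := by
          refine setLIntegral_mono' measurableSet_Ioc fun t ht => ?_
          refine (lintegral_ball_comp_smul_le ht.1.le ht.2 fun x => ‖fderiv ℝ g x‖ₑ ^ 2).trans ?_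
          refine mul_le_of_le_one_left zero_le (ENNReal.ofReal_le_one.2 ?_)
          exact inv_le_one_of_one_le₀ (one_le_pow₀ ht.1.le)
      _ = _ := by
        have h3 : ENNReal.ofReal (4 - 1) = 3 := by norm_num
        simp [h3, mul_comm]
  have hmain : N ≤ 2⁻¹ * N + (2⁻¹ * A + 18 * D) := by
    calc N ≤ ∫⁻ x in Metric.ball (0 : E3) 1, (2 * (16 * w ((4 : ℝ) • x)) +
          6 * ∫⁻ t in Set.Ioc (1 : ℝ) 4, ‖fderiv ℝ g (t • x)‖ₑ ^ 2) := lintegral_mono hpt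
      _ = 2 * (16 * ∫⁻ x in Metric.ball (0 : E3) 1, w ((4 : ℝ) • x)) +
          6 * ∫⁻ x in Metric.ball (0 : E3) 1, ∫⁻ t in Set.Ioc (1 : ℝ) 4,
            ‖fderiv ℝ g (t • x)‖ₑ ^ 2 := by
        rw [lintegral_add_left (by fun_prop), lintegral_const_mul' _ _ (by simp),
          lintegral_const_mul' _ _ (by simp), lintegral_const_mul' _ _ (by simp)]
      _ ≤ 2 * (16 * (ENNReal.ofReal (1 / 64) * (N + A))) + 6 * (3 * D) := by gcongr
      _ = _ := by
        have : (2 : ℝ≥0∞) * (16 * ENNReal.ofReal (1 / 64)) = 2⁻¹ := by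
          rw [show (2 : ℝ≥0∞) = ENNReal.ofReal 2 by simp,
            show (16 : ℝ≥0∞) = ENNReal.ofReal 16 by simp,
            ← ENNReal.ofReal_mul (by norm_num), ← ENNReal.ofReal_mul (by norm_num),
            ← ENNReal.ofReal_inv_of_pos (by norm_num)]
          norm_num
        rw [← mul_assoc 16, ← mul_assoc 2, this]
        ring
  have hhalf : 2⁻¹ * N + 2⁻¹ * N = N := by
    rw [← add_mul, ENNReal.inv_two_add_inv_two, one_mul]
  have hN2 : 2⁻¹ * N ≤ 2⁻¹ * A + 18 * D := by
    have h2 : 2⁻¹ * N ≠ ∞ := ENNReal.mul_ne_top (by simp) hNfin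
    rw [← ENNReal.add_le_add_iff_left h2, hhalf]
    exact hmain
  calc N = 2⁻¹ * N + 2⁻¹ * N := hhalf.symm
    _ ≤ (2⁻¹ * A + 18 * D) + (2⁻¹ * A + 18 * D) := add_le_add hN2 hN2
    _ = (2⁻¹ + 2⁻¹) * A + 12 * 3 * D := by ring
    _ = _ := by
      rw [ENNReal.inv_two_add_inv_two, one_mul, lintegral_add_left (by fun_prop),
        lintegral_const_mul _ (by fun_prop)]

theorem jb_pos (v : E3) : 0 < jb v := by unfold jb; positivity

theorem jb_sq (v : E3) : jb v ^ 2 = 1 + ‖v‖ ^ 2 := by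
  rw [jb, ← Real.rpow_natCast, ← Real.rpow_mul (by positivity)]
  norm_num

theorem one_le_jb (v : E3) : 1 ≤ jb v := by
  nlinarith [jb_sq v, jb_pos v, sq_nonneg ‖v‖]

theorem continuous_jb : Continuous jb := by
  unfold jb
  exact Continuous.rpow_const (by fun_prop) fun v => Or.inl (by positivity)

theorem measurable_jb_rpow (l : ℝ) : Measurable fun v => jb v ^ l :=
  continuous_jb.measurable.pow_const l

theorem jb_le_six_mul {v w : E3} (h : ‖v - w‖ ≤ 4) : jb v ≤ 6 * jb w := by
  have h1 := norm_le_norm_sub_add v w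
  refine le_of_sq_le_sq ?_ (by linarith [jb_pos w])
  rw [mul_pow, jb_sq, jb_sq]
  have h2 : ‖v‖ ≤ 4 + ‖w‖ := by linarith
  have h3 : ‖v‖ ^ 2 ≤ (4 + ‖w‖) ^ 2 := pow_le_pow_left₀ (norm_nonneg v) h2 2
  nlinarith [sq_nonneg (‖w‖ - 1)]

theorem jb_le_two_mul_of_norm_sub_le {v w : E3} {R : ℝ} (hR : 1 ≤ R) (h : ‖v - w‖ ≤ R) :
    jb v ≤ 2 * (R * jb w) := by
  have h1 := norm_le_norm_sub_add v w
  have h0 := norm_nonneg w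
  refine le_of_sq_le_sq ?_ (by have := jb_pos w; positivity)
  rw [mul_pow, mul_pow, jb_sq, jb_sq]
  have h2 : ‖v‖ ≤ R + ‖w‖ := by linarith
  have h3 : ‖v‖ ^ 2 ≤ (R + ‖w‖) ^ 2 := pow_le_pow_left₀ (norm_nonneg v) h2 2
  have hR2 : 1 ≤ R ^ 2 := one_le_pow₀ hR
  nlinarith [sq_nonneg (R - ‖w‖), mul_nonneg (sub_nonneg.2 hR2) (sq_nonneg ‖w‖)]

theorem norm_sub_le_two_mul_jb_mul_jb (v w : E3) : ‖v - w‖ ≤ 2 * (jb v * jb w) := by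
  have hv : ‖v‖ ≤ jb v := le_of_sq_le_sq (by rw [jb_sq]; linarith) (jb_pos v).le
  have hw : ‖w‖ ≤ jb w := le_of_sq_le_sq (by rw [jb_sq]; linarith) (jb_pos w).le
  nlinarith [norm_sub_le v w, one_le_jb v, one_le_jb w,
    mul_nonneg (sub_nonneg.2 (one_le_jb v)) (jb_pos w).le,
    mul_nonneg (sub_nonneg.2 (one_le_jb w)) (jb_pos v).le]

theorem rpow_le_of_le_mul_of_nonpos {a b M p : ℝ} (ha : 0 < a) (hb : 0 < b) (hM : 1 ≤ M)
    (hab : a ≤ M * b) (hp : p ≤ 0) (hp2 : -2 ≤ p) : b ^ p ≤ M ^ 2 * a ^ p := by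
  have hM0 : 0 < M := by linarith
  have h1 : (M * b) ^ p ≤ a ^ p := Real.rpow_le_rpow_of_nonpos ha hab hp
  rw [Real.mul_rpow hM0.le hb.le] at h1
  have h2 : M ^ (-p) ≤ M ^ 2 := by
    rw [← Real.rpow_two]
    exact Real.rpow_le_rpow_of_exponent_le hM (by linarith)
  have h3 : M ^ (-p) * M ^ p = 1 := by rw [← Real.rpow_add hM0]; simp
  calc b ^ p = M ^ (-p) * (M ^ p * b ^ p) := by rw [← mul_assoc, h3, one_mul]
    _ ≤ M ^ 2 * a ^ p := by gcongr

theorem rpow_le_of_le_mul_of_nonneg {a b M p : ℝ} (ha : 0 ≤ a) (hb : 0 ≤ b) (hM : 1 ≤ M)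
    (hab : a ≤ M * b) (hp : 0 ≤ p) (hp2 : p ≤ 2) : a ^ p ≤ M ^ 2 * b ^ p := by
  have hM0 : 0 < M := by linarith
  have h2 : M ^ p ≤ M ^ 2 := by
    rw [← Real.rpow_two]
    exact Real.rpow_le_rpow_of_exponent_le hM hp2
  calc a ^ p ≤ (M * b) ^ p := Real.rpow_le_rpow ha hab hp
    _ = M ^ p * b ^ p := Real.mul_rpow hM0.le hb
    _ ≤ M ^ 2 * b ^ p := by gcongr

theorem jb_rpow_le {v w : E3} {l : ℝ} (hl : l ∈ Set.Icc (-2 : ℝ) 2) (h : ‖v - w‖ ≤ 4) :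
    jb v ^ l ≤ 36 * jb w ^ l := by
  have h36 : (36 : ℝ) = 6 ^ 2 := by norm_num
  rw [h36]
  rcases le_total 0 l with h0 | h0
  · exact rpow_le_of_le_mul_of_nonneg (jb_pos v).le (jb_pos w).le (by norm_num)
      (jb_le_six_mul h) h0 hl.2
  · exact rpow_le_of_le_mul_of_nonpos (jb_pos w) (jb_pos v) (by norm_num)
      (jb_le_six_mul (by rwa [norm_sub_rev])) h0 hl.1

/-- The singular kernel `|x|⁻¹`, cut off to the unit ball. -/
def nearKernel (x : EuclideanSpace ℝ (Fin 3)) : ℝ := (Metric.ball 0 1).indicator (‖·‖⁻¹) x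

theorem nearKernel_nonneg (x : E3) : 0 ≤ nearKernel x :=
  Set.indicator_nonneg (fun y _ => inv_nonneg.2 (norm_nonneg y)) x

theorem measurable_nearKernel : Measurable nearKernel :=
  measurable_norm.inv.indicator Metric.isOpen_ball.measurableSet

theorem norm_sub_rpow_le {p : ℝ} (hp : p ∈ Set.Icc (-2 : ℝ) 2) (v w : E3) :
    ‖v - w‖ ^ p ≤ 4 * (1 + nearKernel (v - w) ^ 2) * (jb v ^ p * jb w ^ (2 : ℝ)) := by
  have hv := jb_pos v
  have hw := jb_pos w
  set r := ‖v - w‖ with hr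
  have hr0 : 0 ≤ r := norm_nonneg _
  have hk := sq_nonneg (nearKernel (v - w))
  have hprod : 0 < jb v ^ p * jb w ^ (2 : ℝ) := by positivity
  rcases le_or_gt 0 p with h0 | h0
  · have h1 := rpow_le_of_le_mul_of_nonneg hr0 (by positivity) (by norm_num)
      (norm_sub_le_two_mul_jb_mul_jb v w) h0 hp.2
    rw [Real.mul_rpow hv.le hw.le] at h1
    have h2 : jb w ^ p ≤ jb w ^ (2 : ℝ) :=
      Real.rpow_le_rpow_of_exponent_le (one_le_jb w) hp.2
    have h3 : jb v ^ p * jb w ^ p ≤ jb v ^ p * jb w ^ (2 : ℝ) := by gcongr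
    nlinarith [mul_nonneg hk hprod.le]
  have key : ∀ R : ℝ, 1 ≤ R → r ≤ R → R ^ p ≤ 4 * (jb v ^ p * jb w ^ (2 : ℝ)) := by
    intro R hR hrR
    have h1 := rpow_le_of_le_mul_of_nonpos hv (by positivity) (by norm_num)
      (jb_le_two_mul_of_norm_sub_le hR hrR) h0.le hp.1
    rw [Real.mul_rpow (by positivity) hw.le] at h1
    have h2 : jb w ^ (-p) ≤ jb w ^ (2 : ℝ) :=
      Real.rpow_le_rpow_of_exponent_le (one_le_jb w) (by linarith [hp.1])
    have h3 : jb w ^ p * jb w ^ (-p) = 1 := by rw [← Real.rpow_add hw]; simp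
    calc R ^ p = (R ^ p * jb w ^ p) * jb w ^ (-p) := by rw [mul_assoc, h3, mul_one]
      _ ≤ (2 ^ 2 * jb v ^ p) * jb w ^ (2 : ℝ) := by gcongr
      _ = _ := by ring
  rcases le_or_gt 1 r with h1 | h1
  · nlinarith [key r h1 le_rfl, mul_nonneg hk hprod.le]
  · have h2 := key 1 le_rfl h1.le
    rw [Real.one_rpow] at h2
    have h3 : r ^ p ≤ nearKernel (v - w) ^ 2 := by
      have hmem : v - w ∈ Metric.ball (0 : E3) 1 := by simpa [← hr] using h1
      rw [nearKernel, Set.indicator_of_mem hmem]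
      simp only [← hr]
      rcases hr0.eq_or_lt with hz | hz
      · rw [← hz, Real.zero_rpow h0.ne]; positivity
      · have := Real.rpow_le_rpow_of_exponent_ge hz h1.le hp.1
        rwa [Real.rpow_neg hz.le, Real.rpow_two, ← inv_pow] at this
    nlinarith [mul_nonneg hk (sub_nonneg.2 h2), mul_nonneg hk hprod.le]

theorem eL2w_sq (l : ℝ) (f : E3 → ℝ) :
    eL2w l f ^ 2 = ∫⁻ v, ENNReal.ofReal (jb v ^ l * |f v|) ^ 2 := rpow_half_sq _

theorem eL2gradw_sq (l : ℝ) (f : E3 → ℝ) :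
    eL2gradw l f ^ 2 = ∫⁻ v, ENNReal.ofReal (jb v ^ l * ‖gradient f v‖) ^ 2 := rpow_half_sq _

theorem eL2w_mono {k l : ℝ} (hkl : k ≤ l) (f : E3 → ℝ) : eL2w k f ≤ eL2w l f := by
  unfold eL2w
  gcongr with v
  exact one_le_jb v

theorem lintegral_nearKernel_sq_lt_top :
    ∫⁻ x, ENNReal.ofReal (nearKernel x) ^ 2 < ∞ := by
  refine lt_of_eq_of_lt ?_ lintegral_inv_norm_sq_ball_lt_top
  rw [← lintegral_indicator Metric.isOpen_ball.measurableSet]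
  congr with x
  by_cases hx : x ∈ Metric.ball (0 : E3) 1
  · rw [nearKernel, Set.indicator_of_mem hx, Set.indicator_of_mem hx,
      ENNReal.ofReal_pow (by positivity)]
  · simp [nearKernel, hx]

theorem lintegral_nearKernel_mul_sq_le {l : ℝ} (hl : l ∈ Set.Icc (-2 : ℝ) 2) {g : E3 → ℝ}
    (hg : ContDiff ℝ 1 g) (w : E3) :
    ∫⁻ v, (ENNReal.ofReal (nearKernel (v - w)) * ENNReal.ofReal (jb v ^ l * |g v|)) ^ 2 ≤
      36 ^ 5 * eH1w l g ^ 2 := by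
  have hcont : Continuous (fderiv ℝ g) := hg.continuous_fderiv (by norm_num)
  have hgc : Continuous g := hg.continuous
  have hjm := measurable_jb_rpow l
  set gw : E3 → ℝ := fun x => g (x + w) with hgw
  have hgwd : ContDiff ℝ 1 gw := hg.comp (contDiff_id.add contDiff_const)
  have hfd : ∀ x, fderiv ℝ gw x = fderiv ℝ g (x + w) := fun x => fderiv_comp_add_right w
  set c : ℝ≥0∞ := ENNReal.ofReal (jb w ^ l) with hc
  have hle1 : ∀ x : E3, ‖x‖ ≤ 4 → ENNReal.ofReal (jb (x + w) ^ l) ≤ 36 * c := by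
    intro x hx
    have h := ENNReal.ofReal_le_ofReal (jb_rpow_le (v := x + w) (w := w) hl (by simpa using hx))
    rwa [ENNReal.ofReal_mul (by norm_num), ENNReal.ofReal_ofNat] at h
  have hle2 : ∀ x : E3, ‖x‖ ≤ 4 → c ≤ 36 * ENNReal.ofReal (jb (x + w) ^ l) := by
    intro x hx
    have h := ENNReal.ofReal_le_ofReal (jb_rpow_le (v := w) (w := x + w) hl (by simpa using hx))
    rwa [ENNReal.ofReal_mul (by norm_num), ENNReal.ofReal_ofNat] at h
  have hG : ∀ v, ENNReal.ofReal (jb v ^ l * |g v|) = ENNReal.ofReal (jb v ^ l) * ‖g v‖ₑ := by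
    intro v
    rw [ENNReal.ofReal_mul (Real.rpow_nonneg (jb_pos v).le l), Real.enorm_eq_ofReal_abs]
  have hG' : ∀ v, ENNReal.ofReal (jb v ^ l * ‖gradient g v‖) =
      ENNReal.ofReal (jb v ^ l) * ‖fderiv ℝ g v‖ₑ := by
    intro v
    rw [ENNReal.ofReal_mul (Real.rpow_nonneg (jb_pos v).le l), gradient,
      LinearIsometryEquiv.norm_map, ofReal_norm]
  have hctop : (36 * c) ^ 2 ≠ ∞ := by simp [hc, ENNReal.mul_eq_top]
  calc _ = ∫⁻ x, (ENNReal.ofReal (nearKernel x) *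
        (ENNReal.ofReal (jb (x + w) ^ l) * ‖g (x + w)‖ₑ)) ^ 2 := by
        rw [← lintegral_add_right_eq_self _ w]
        simp only [add_sub_cancel_right, hG]
    _ ≤ ∫⁻ x in Metric.ball (0 : E3) 1, (36 * c) ^ 2 * (‖‖x‖⁻¹‖ₑ ^ 2 * ‖gw x‖ₑ ^ 2) := by
        rw [← lintegral_indicator Metric.isOpen_ball.measurableSet]
        refine lintegral_mono fun x => ?_
        by_cases hx : x ∈ Metric.ball (0 : E3) 1
        · rw [nearKernel, Set.indicator_of_mem hx, Set.indicator_of_mem hx,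
            ← Real.enorm_eq_ofReal (by positivity), ← mul_pow, ← mul_pow]
          have h1 := hle1 x (by have : ‖x‖ < 1 := by simpa using hx
                                linarith)
          calc _ ≤ (‖‖x‖⁻¹‖ₑ * (36 * c * ‖g (x + w)‖ₑ)) ^ 2 := by gcongr
            _ = _ := by simp only [hgw]; ring
        · simp [nearKernel, hx]
    _ ≤ (36 * c) ^ 2 *
        ∫⁻ x in Metric.ball (0 : E3) 4, (‖gw x‖ₑ ^ 2 + 12 * 3 * ‖fderiv ℝ gw x‖ₑ ^ 2) := by
        rw [lintegral_const_mul' _ _ hctop]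
        exact mul_le_mul_right (lintegral_inv_norm_sq_mul_ball_le hgwd) _
    _ ≤ ∫⁻ x in Metric.ball (0 : E3) 4, 36 ^ 5 * (ENNReal.ofReal (jb (x + w) ^ l * |g (x + w)|) ^ 2
          + ENNReal.ofReal (jb (x + w) ^ l * ‖gradient g (x + w)‖) ^ 2) := by
        rw [← lintegral_const_mul' _ _ hctop]
        refine setLIntegral_mono' Metric.isOpen_ball.measurableSet fun x hx => ?_
        rw [hG, hG', hfd]
        have h2 := hle2 x (by have : ‖x‖ < 4 := by simpa using hx
                              linarith)
        have h12 : (12 * 3 : ℝ≥0∞) = 36 := by norm_num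
        calc _ ≤ (36 * (36 * ENNReal.ofReal (jb (x + w) ^ l))) ^ 2 *
              (36 * ‖g (x + w)‖ₑ ^ 2 + 36 * ‖fderiv ℝ g (x + w)‖ₑ ^ 2) := by
              rw [h12]
              gcongr
              exact le_mul_of_one_le_left zero_le (by norm_num)
          _ = _ := by ring
    _ ≤ ∫⁻ x, 36 ^ 5 * (ENNReal.ofReal (jb (x + w) ^ l * |g (x + w)|) ^ 2
          + ENNReal.ofReal (jb (x + w) ^ l * ‖gradient g (x + w)‖) ^ 2) :=
        setLIntegral_le_lintegral _ _
    _ = 36 ^ 5 * (eL2w l g ^ 2 + eL2gradw l g ^ 2) := by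
        rw [lintegral_add_right_eq_self (fun x => 36 ^ 5 * (ENNReal.ofReal (jb x ^ l * |g x|) ^ 2
          + ENNReal.ofReal (jb x ^ l * ‖gradient g x‖) ^ 2)) w,
          lintegral_const_mul' _ _ (by simp), lintegral_add_left, eL2w_sq, eL2gradw_sq]
        have := hgc.measurable
        fun_prop
    _ ≤ 36 ^ 5 * eH1w l g ^ 2 := by
        gcongr
        rw [eH1w, add_sq]
        gcongr
        exact le_self_add

theorem eL2w_neg_three_one_lt_top : eL2w (-3) (fun _ => 1) < ∞ := by
  have h : Integrable (fun v : E3 => (1 + ‖v‖ ^ 2) ^ (-(6 : ℝ) / 2)) :=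
    integrable_rpow_neg_one_add_norm_sq (by simp; norm_num)
  refine ENNReal.rpow_lt_top_of_nonneg (by norm_num) (lt_of_eq_of_lt ?_ h.lintegral_lt_top).ne
  congr with v
  rw [← ENNReal.ofReal_pow (by have := jb_pos v; positivity), abs_one, mul_one, jb,
    ← Real.rpow_mul (by positivity), ← Real.rpow_natCast, ← Real.rpow_mul (by positivity)]
  norm_num

theorem measurable_jb_rpow_mul_abs (l : ℝ) {f : E3 → ℝ} (hf : Measurable f) :
    Measurable fun v => ENNReal.ofReal (jb v ^ l * |f v|) :=
  ((measurable_jb_rpow l).mul hf.norm).ennreal_ofReal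

theorem lintegral_jb_sq_mul_le {f : E3 → ℝ} (hf : Measurable f) :
    ∫⁻ w, ENNReal.ofReal (jb w ^ (2 : ℝ) * |f w|) ≤ eL2w 5 f * eL2w (-3) (fun _ => 1) := by
  refine le_trans (le_of_eq ?_) (lintegral_mul_le_sqrt_mul_sqrt
    (measurable_jb_rpow_mul_abs 5 hf).aemeasurable
    (measurable_jb_rpow_mul_abs (-3) (f := fun _ => 1) measurable_const).aemeasurable)
  congr with w
  have hw := jb_pos w
  rw [← ENNReal.ofReal_mul (by positivity), abs_one, mul_one, mul_right_comm, ← Real.rpow_add hw]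
  norm_num

theorem lintegral_lintegral_nearKernel_le {l m : ℝ} (hl : l ∈ Set.Icc (-2 : ℝ) 2)
    {f g h : E3 → ℝ} (hf : Measurable f) (hh : Measurable h) (hg : ContDiff ℝ 1 g) :
    ∫⁻ v, ∫⁻ w, (ENNReal.ofReal (nearKernel (v - w)) * ENNReal.ofReal (jb w ^ (2 : ℝ) * |f w|) *
        ENNReal.ofReal (jb v ^ l * |g v|)) *
        (ENNReal.ofReal (nearKernel (v - w)) * ENNReal.ofReal (jb v ^ m * |h v|)) ≤
      (36 ^ 5) ^ ((1 : ℝ) / 2) *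
        (∫⁻ x, ENNReal.ofReal (nearKernel x) ^ 2) ^ ((1 : ℝ) / 2) *
        (eL2w 5 f * eH1w l g * eL2w m h) := by
  set F := fun w : E3 => ENNReal.ofReal (jb w ^ (2 : ℝ) * |f w|)
  set G := fun v : E3 => ENNReal.ofReal (jb v ^ l * |g v|)
  set H := fun v : E3 => ENNReal.ofReal (jb v ^ m * |h v|)
  set k := fun x : E3 => ENNReal.ofReal (nearKernel x)
  have hF : Measurable F := measurable_jb_rpow_mul_abs 2 hf
  have hG : Measurable G := measurable_jb_rpow_mul_abs l hg.continuous.measurable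
  have hH : Measurable H := measurable_jb_rpow_mul_abs m hh
  have hk : Measurable k := measurable_nearKernel.ennreal_ofReal
  have hA : Measurable fun z : E3 × E3 => k (z.1 - z.2) * F z.2 * G z.1 := by fun_prop
  have hB : Measurable fun z : E3 × E3 => k (z.1 - z.2) * H z.1 := by fun_prop
  have hAint : ∫⁻ z : E3 × E3, (k (z.1 - z.2) * F z.2 * G z.1) ^ 2 ≤
      36 ^ 5 * (eL2w 5 f * eH1w l g) ^ 2 := by
    rw [Measure.volume_eq_prod, lintegral_prod_symm _ (hA.pow_const 2).aemeasurable]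
    calc _ = ∫⁻ w, F w ^ 2 * ∫⁻ v, (k (v - w) * G v) ^ 2 := by
          congr with w
          rw [← lintegral_const_mul _ (by fun_prop)]
          congr with v
          ring
      _ ≤ ∫⁻ w, F w ^ 2 * (36 ^ 5 * eH1w l g ^ 2) := by
          gcongr with w
          exact lintegral_nearKernel_mul_sq_le hl hg w
      _ = eL2w 2 f ^ 2 * (36 ^ 5 * eH1w l g ^ 2) := by
          rw [lintegral_mul_const _ (by fun_prop), eL2w_sq]
      _ ≤ eL2w 5 f ^ 2 * (36 ^ 5 * eH1w l g ^ 2) := by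
          gcongr
          exact eL2w_mono (by norm_num) f
      _ = _ := by ring
  have hBint : ∫⁻ z : E3 × E3, (k (z.1 - z.2) * H z.1) ^ 2 =
      (∫⁻ x, k x ^ 2) * eL2w m h ^ 2 := by
    rw [Measure.volume_eq_prod, lintegral_prod _ (hB.pow_const 2).aemeasurable]
    calc _ = ∫⁻ v, (∫⁻ x, k x ^ 2) * H v ^ 2 := by
          congr with v
          simp only [mul_pow]
          rw [lintegral_mul_const _ (by fun_prop),
            lintegral_sub_left_eq_self (fun x => k x ^ 2) v]
      _ = _ := by rw [lintegral_const_mul _ (by fun_prop), eL2w_sq]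
  calc _ = ∫⁻ z : E3 × E3, (k (z.1 - z.2) * F z.2 * G z.1) * (k (z.1 - z.2) * H z.1) := by
        rw [Measure.volume_eq_prod]
        exact (lintegral_prod (fun z : E3 × E3 => (k (z.1 - z.2) * F z.2 * G z.1) *
          (k (z.1 - z.2) * H z.1)) (hA.mul hB).aemeasurable).symm
    _ ≤ _ := lintegral_mul_le_sqrt_mul_sqrt hA.aemeasurable hB.aemeasurable
    _ ≤ (36 ^ 5 * (eL2w 5 f * eH1w l g) ^ 2) ^ ((1 : ℝ) / 2) *
        ((∫⁻ x, k x ^ 2) * eL2w m h ^ 2) ^ ((1 : ℝ) / 2) := by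
        rw [hBint]
        gcongr
    _ = _ := by
        rw [ENNReal.mul_rpow_of_nonneg _ _ (by norm_num : (0 : ℝ) ≤ 1 / 2),
          ENNReal.mul_rpow_of_nonneg _ _ (by norm_num : (0 : ℝ) ≤ 1 / 2), sq_rpow_half,
          sq_rpow_half]
        ring

theorem lintegral_lintegral_norm_sub_rpow_le {γ : ℝ} (hγ : γ ∈ Set.Icc (-3 : ℝ) 1)
    {f g h : E3 → ℝ} (hf : Measurable f) (hh : Measurable h) (hg : ContDiff ℝ 1 g) :
    ∫⁻ v, ∫⁻ w, ENNReal.ofReal (‖v - w‖ ^ (γ + 1) * |f w| * |g v| * |h v|) ≤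
      4 * (eL2w (-3) (fun _ => 1) + (36 ^ 5) ^ ((1 : ℝ) / 2) *
        (∫⁻ x, ENNReal.ofReal (nearKernel x) ^ 2) ^ ((1 : ℝ) / 2)) *
        (eL2w 5 f * eH1w (γ / 2 + 1) g * eL2w (γ / 2) h) := by
  have hnear := lintegral_lintegral_nearKernel_le (l := γ / 2 + 1) (m := γ / 2)
    ⟨by linarith [hγ.1], by linarith [hγ.2]⟩ hf hh hg
  have hf1 := lintegral_jb_sq_mul_le hf
  set F := fun w : E3 => ENNReal.ofReal (jb w ^ (2 : ℝ) * |f w|) with hFd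
  set G := fun v : E3 => ENNReal.ofReal (jb v ^ (γ / 2 + 1) * |g v|) with hGd
  set H := fun v : E3 => ENNReal.ofReal (jb v ^ (γ / 2) * |h v|) with hHd
  set k := fun x : E3 => ENNReal.ofReal (nearKernel x) with hkd
  have hF : Measurable F := measurable_jb_rpow_mul_abs 2 hf
  have hG : Measurable G := measurable_jb_rpow_mul_abs _ hg.continuous.measurable
  have hH : Measurable H := measurable_jb_rpow_mul_abs _ hh
  have hk : Measurable k := measurable_nearKernel.ennreal_ofReal
  have hpt : ∀ v w, ENNReal.ofReal (‖v - w‖ ^ (γ + 1) * |f w| * |g v| * |h v|) ≤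
      4 * (G v * H v * F w + (k (v - w) * F w * G v) * (k (v - w) * H v)) := by
    intro v w
    have hv := jb_pos v
    have hw := jb_pos w
    have hkn := nearKernel_nonneg (v - w)
    have hb := norm_sub_rpow_le (p := γ + 1) ⟨by linarith [hγ.1], by linarith [hγ.2]⟩ v w
    rw [show γ + 1 = (γ / 2 + 1) + γ / 2 by ring, Real.rpow_add hv] at hb
    rw [show γ + 1 = (γ / 2 + 1) + γ / 2 by ring]
    have hreal : ‖v - w‖ ^ ((γ / 2 + 1) + γ / 2) * |f w| * |g v| * |h v| ≤
        4 * ((jb v ^ (γ / 2 + 1) * |g v|) * (jb v ^ (γ / 2) * |h v|) *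
          (jb w ^ (2 : ℝ) * |f w|) + (nearKernel (v - w) * (jb w ^ (2 : ℝ) * |f w|) *
          (jb v ^ (γ / 2 + 1) * |g v|)) * (nearKernel (v - w) * (jb v ^ (γ / 2) * |h v|))) := by
      calc _ ≤ (4 * (1 + nearKernel (v - w) ^ 2) *
            (jb v ^ (γ / 2 + 1) * jb v ^ (γ / 2) * jb w ^ (2 : ℝ))) * |f w| * |g v| * |h v| := by
              gcongr
        _ = _ := by ring
    refine (ENNReal.ofReal_le_ofReal hreal).trans (le_of_eq ?_)
    simp only [hFd, hGd, hHd, hkd]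
    rw [ENNReal.ofReal_mul (by norm_num), ENNReal.ofReal_add (by positivity) (by positivity)]
    simp only [ENNReal.ofReal_ofNat]
    congr 2
    · rw [ENNReal.ofReal_mul (by positivity), ENNReal.ofReal_mul (by positivity)]
    · rw [ENNReal.ofReal_mul (by positivity), ENNReal.ofReal_mul (by positivity),
        ENNReal.ofReal_mul hkn, ENNReal.ofReal_mul hkn]
  have hGH : ∫⁻ v, G v * H v ≤ eH1w (γ / 2 + 1) g * eL2w (γ / 2) h :=
    (lintegral_mul_le_sqrt_mul_sqrt hG.aemeasurable hH.aemeasurable).trans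
      (mul_le_mul_left le_self_add _)
  have hfar : ∫⁻ v, ∫⁻ w, G v * H v * F w ≤
      eL2w (-3) (fun _ => 1) * (eL2w 5 f * eH1w (γ / 2 + 1) g * eL2w (γ / 2) h) := by
    calc _ = (∫⁻ v, G v * H v) * ∫⁻ w, F w := by
          rw [← lintegral_mul_const _ (by fun_prop)]
          congr with v
          rw [lintegral_const_mul _ hF]
      _ ≤ (eH1w (γ / 2 + 1) g * eL2w (γ / 2) h) *
          (eL2w 5 f * eL2w (-3) (fun _ => 1)) := by gcongr
      _ = _ := by ring
  calc _ ≤ ∫⁻ v, ∫⁻ w, 4 * (G v * H v * F w + (k (v - w) * F w * G v) * (k (v - w) * H v)) :=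
        lintegral_mono fun v => lintegral_mono fun w => hpt v w
    _ = 4 * ((∫⁻ v, ∫⁻ w, G v * H v * F w) +
        ∫⁻ v, ∫⁻ w, (k (v - w) * F w * G v) * (k (v - w) * H v)) := by
        rw [← lintegral_add_left (by fun_prop), ← lintegral_const_mul' _ _ (by simp)]
        congr with v
        rw [← lintegral_add_left (by fun_prop), ← lintegral_const_mul' _ _ (by simp)]
    _ ≤ 4 * (_ + _) := mul_le_mul_right (add_le_add hfar hnear) 4
    _ = _ := by ring

/-- For `γ ∈ [-3,1]` there is `C > 0` depending only on `γ` such that for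
all measurable `f, h` and every `C¹` function `g`,
`∫∫ |v-v_*|^(γ+1) |f(v_*)| |g(v)| |h(v)| dv_* dv
  ≤ C ‖f‖_{L²_5} ‖g‖_{H¹_{γ/2+1}} ‖h‖_{L²_{γ/2}}`. -/
theorem convolution_weight_bound_gamma_add_one' (γ : ℝ) (hγ : γ ∈ Set.Icc (-3 : ℝ) 1) :
    ∃ C : ℝ, 0 < C ∧
      ∀ f g h : EuclideanSpace ℝ (Fin 3) → ℝ,
        Measurable f → Measurable h → ContDiff ℝ 1 g →
        (∫⁻ v, ∫⁻ vs, ENNReal.ofReal (‖v - vs‖ ^ (γ + 1) * |f vs| * |g v| * |h v|)) ≤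
          ENNReal.ofReal C * eL2w 5 f * eH1w (γ / 2 + 1) g * eL2w (γ / 2) h := by
  set K : ℝ≥0∞ := 4 * (eL2w (-3) (fun _ => 1) + (36 ^ 5) ^ ((1 : ℝ) / 2) *
    (∫⁻ x, ENNReal.ofReal (nearKernel x) ^ 2) ^ ((1 : ℝ) / 2)) with hK
  have hKtop : K ≠ ∞ := by
    refine ENNReal.mul_ne_top (by simp) (ENNReal.add_ne_top.2
      ⟨eL2w_neg_three_one_lt_top.ne, ENNReal.mul_ne_top ?_ ?_⟩)
    · exact ENNReal.rpow_ne_top_of_nonneg (by norm_num) (by simp)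
    · exact ENNReal.rpow_ne_top_of_nonneg (by norm_num) lintegral_nearKernel_sq_lt_top.ne
  refine ⟨K.toReal + 1, by positivity, fun f g h hf hh hg => ?_⟩
  have hKC : K ≤ ENNReal.ofReal (K.toReal + 1) := by
    rw [← ENNReal.ofReal_toReal hKtop]
    exact ENNReal.ofReal_le_ofReal (by rw [ENNReal.toReal_ofReal (by positivity)]; linarith)
  calc _ ≤ K * (eL2w 5 f * eH1w (γ / 2 + 1) g * eL2w (γ / 2) h) :=
        lintegral_lintegral_norm_sub_rpow_le hγ hf hh hg
    _ ≤ ENNReal.ofReal (K.toReal + 1) *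
        (eL2w 5 f * eH1w (γ / 2 + 1) g * eL2w (γ / 2) h) := by gcongr
    _ = _ := by ring
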